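/- Let Ψ(u) = ∫_u^∞ (2π)^{−1/2} e^{−y²/2} dy denote the standard normal tail. Fix constants C > 0, κ ∈ ℝ and x ∈ ℝ. For S > 1 set a_S = √(2 ln S), b_S = a_S + a_S^{−1} ln( (2π)^{−1/2} C a_S^{κ−1} ), and u_S = x / a_S + b_S. Then lim_{S→∞} S · C · u_S^{κ} · Ψ(u_S) = e^{−x}. -/

import Mathlib

open Filter

theorem hasDerivAt_integral_Ioi {f : ℝ → ℝ} (hf : Continuous f)
    (hfi : MeasureTheory.Integrable f) (u : ℝ) :
    HasDerivAt (fun v => ∫ y in Set.Ioi v, f y) (-f u) u := by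
  have h (v : ℝ) : ∫ y in Set.Ioi v, f y = (∫ y in Set.Ioi 0, f y) - ∫ y in (0 : ℝ)..v, f y := by
    rw [← intervalIntegral.integral_interval_add_Ioi hfi.integrableOn hfi.integrableOn (a := 0)
      (b := v)]
    ring
  rw [funext h]
  exact (intervalIntegral.integral_hasDerivAt_right (hf.intervalIntegrable _ _)
    (hf.stronglyMeasurableAtFilter _ _) hf.continuousAt).const_sub _

theorem hasDerivAt_exp_neg_sq_div_two (u : ℝ) :
    HasDerivAt (fun v : ℝ => Real.exp (-v ^ 2 / 2)) (-u * Real.exp (-u ^ 2 / 2)) u := by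
  have h : HasDerivAt (fun v : ℝ => -v ^ 2 / 2) (-u) u := by
    refine ((hasDerivAt_pow 2 u).fun_neg.div_const 2).congr_deriv ?_
    norm_num
    ring
  exact h.exp.congr_deriv (mul_comm _ _)

theorem integrable_exp_neg_sq_div_two :
    MeasureTheory.Integrable (fun y : ℝ => Real.exp (-y ^ 2 / 2)) := by
  convert integrable_exp_neg_mul_sq (b := 1 / 2) (by norm_num) using 3
  ring

theorem tendsto_exp_neg_sq_div_two_div_atTop :
    Tendsto (fun u : ℝ => Real.exp (-u ^ 2 / 2) / u) atTop (nhds 0) := by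
  refine squeeze_zero' ?_ ?_ tendsto_inv_atTop_zero
  · filter_upwards [eventually_gt_atTop 0] with u hu
    positivity
  · filter_upwards [eventually_gt_atTop 0] with u hu
    rw [div_eq_mul_inv]
    refine mul_le_of_le_one_left (by positivity) (Real.exp_le_one_iff.2 ?_)
    nlinarith

/-- Asymptotics of the Mills ratio of the standard normal distribution. -/
theorem tendsto_mul_exp_mul_integral_Ioi_exp_neg_sq :
    Tendsto (fun u : ℝ => u * Real.exp (u ^ 2 / 2) * ∫ y in Set.Ioi u, Real.exp (-y ^ 2 / 2))
      atTop (nhds 1) := by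
  have key : Tendsto (fun u : ℝ =>
      (∫ y in Set.Ioi u, Real.exp (-y ^ 2 / 2)) / (Real.exp (-u ^ 2 / 2) / u)) atTop (nhds 1) := by
    refine HasDerivAt.lhopital_zero_atTop (f' := fun u => -Real.exp (-u ^ 2 / 2))
      (g' := fun u => -(Real.exp (-u ^ 2 / 2) * (1 + (u ^ 2)⁻¹)))
      (.of_forall fun u => hasDerivAt_integral_Ioi (by fun_prop) integrable_exp_neg_sq_div_two u)
      ?_ ?_ (MeasureTheory.tendsto_integral_Ioi_zero tendsto_id)
      tendsto_exp_neg_sq_div_two_div_atTop ?_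
    · filter_upwards [eventually_gt_atTop 0] with u hu
      refine ((hasDerivAt_exp_neg_sq_div_two u).fun_div (hasDerivAt_id' u) hu.ne').congr_deriv ?_
      field_simp
      ring
    · filter_upwards [eventually_gt_atTop 0] with u hu
      exact neg_ne_zero.2 (by positivity)
    · have h : Tendsto (fun u : ℝ => (1 + (u ^ 2)⁻¹)⁻¹) atTop (nhds 1) := by
        have h2 : Tendsto (fun u : ℝ => (u ^ 2)⁻¹) atTop (nhds 0) :=
          tendsto_inv_atTop_zero.comp (tendsto_pow_atTop two_ne_zero)
        simpa using (h2.const_add 1).inv₀ (by simp)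
      refine h.congr fun u => ?_
      have h1 : 1 + (u ^ 2)⁻¹ ≠ 0 := by positivity
      have := (Real.exp_pos (-u ^ 2 / 2)).ne'
      field_simp
  refine key.congr fun u => ?_
  rw [neg_div, Real.exp_neg]
  simp only [div_eq_mul_inv, mul_inv, inv_inv]
  ring

theorem tendsto_add_log_mul_rpow_div_atTop (x p : ℝ) {K : ℝ} (hK : 0 < K) :
    Tendsto (fun t : ℝ => (x + Real.log (K * t ^ p)) / t) atTop (nhds 0) := by
  have h1 : Tendsto (fun t : ℝ => (x + Real.log K) / t) atTop (nhds 0) :=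
    tendsto_id.const_div_atTop _
  have h2 : Tendsto (fun t : ℝ => p * (Real.log t / t)) atTop (nhds 0) := by
    simpa using (Real.tendsto_pow_log_div_mul_add_atTop 1 0 1 one_ne_zero).const_mul p
  refine Tendsto.congr' ?_ (by simpa using h1.add h2)
  filter_upwards [eventually_gt_atTop 0] with t ht
  rw [Real.log_mul hK.ne' (by positivity), Real.log_rpow ht]
  ring

/-- The Gumbel limit, parametrized by the leading term `t = √(2 log S)` of the threshold. -/
theorem tendsto_exp_sq_mul_rpow_mul_gaussian_tail (κ x : ℝ) {K : ℝ} (hK : 0 < K) :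
    Tendsto (fun t : ℝ => Real.exp (t ^ 2 / 2) * K *
        (t + (x + Real.log (K * t ^ (κ - 1))) / t) ^ κ *
        ∫ y in Set.Ioi (t + (x + Real.log (K * t ^ (κ - 1))) / t), Real.exp (-y ^ 2 / 2))
      atTop (nhds (Real.exp (-x))) := by
  set r : ℝ → ℝ := fun t => (x + Real.log (K * t ^ (κ - 1))) / t with hr
  have hr0 : Tendsto r atTop (nhds 0) := tendsto_add_log_mul_rpow_div_atTop x (κ - 1) hK
  have hu : Tendsto (fun t => t + r t) atTop atTop := tendsto_id.atTop_add hr0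
  have hratio : Tendsto (fun t => (1 + r t / t) ^ (κ - 1)) atTop (nhds 1) := by
    have h : Tendsto (fun t => 1 + r t / t) atTop (nhds 1) := by
      simpa using (hr0.div_atTop tendsto_id).const_add 1
    simpa using h.rpow_const (p := κ - 1) (.inl one_ne_zero)
  have hsq : Tendsto (fun t => Real.exp (-r t ^ 2 / 2)) atTop (nhds 1) := by
    have h : Tendsto (fun t => -r t ^ 2 / 2) atTop (nhds 0) := by
      simpa using (hr0.pow 2).neg.div_const 2
    exact Real.exp_zero ▸ (Real.continuous_exp.tendsto 0).comp h
  have hlim := (((tendsto_mul_exp_mul_integral_Ioi_exp_neg_sq.comp hu).mul hratio).mul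
    hsq).mul_const (Real.exp (-x))
  simp only [one_mul] at hlim
  refine hlim.congr' ?_
  filter_upwards [eventually_gt_atTop 0, hu.eventually_gt_atTop 0] with t ht hut
  have hKt : 0 < K * t ^ (κ - 1) := by positivity
  have hexp : Real.exp ((t + r t) ^ 2 / 2) * Real.exp (-r t ^ 2 / 2) * Real.exp (-x) =
      Real.exp (t ^ 2 / 2) * (K * t ^ (κ - 1)) := by
    have hrt : t * r t = x + Real.log (K * t ^ (κ - 1)) := by
      simp only [hr]
      field_simp
    rw [← Real.exp_log hKt]
    simp only [← Real.exp_add]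
    congr 1
    linear_combination hrt
  have hpow : t ^ (κ - 1) * (1 + r t / t) ^ (κ - 1) * (t + r t) = (t + r t) ^ κ := by
    have h : 1 + r t / t = (t + r t) / t := by field_simp
    rw [h, Real.div_rpow hut.le ht.le, mul_div_cancel₀ _ (by positivity),
      ← Real.rpow_add_one hut.ne', sub_add_cancel]
  simp only [Function.comp_apply]
  rw [← hpow]
  linear_combination ((t + r t) * (1 + r t / t) ^ (κ - 1) *
    ∫ y in Set.Ioi (t + r t), Real.exp (-y ^ 2 / 2)) * hexp

theorem stmt14 (C κ x : ℝ) (hC : 0 < C)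
    (Ψ : ℝ → ℝ)
    (hΨ : ∀ u, Ψ u = ∫ y in Set.Ioi u, (2 * Real.pi) ^ (-(1:ℝ) / 2) * Real.exp (-y ^ 2 / 2))
    (a b u : ℝ → ℝ)
    (ha : ∀ S, a S = Real.sqrt (2 * Real.log S))
    (hb : ∀ S, b S = a S + Real.log ((2 * Real.pi) ^ (-(1:ℝ) / 2) * C * a S ^ (κ - 1)) / a S)
    (hu : ∀ S, u S = x / a S + b S) :
    Tendsto (fun S => S * C * u S ^ κ * Ψ (u S)) atTop (nhds (Real.exp (-x))) := by
  have hK : 0 < (2 * Real.pi) ^ (-(1:ℝ) / 2) * C := by positivity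
  have ha_top : Tendsto a atTop atTop := by
    rw [funext ha]
    exact Real.tendsto_sqrt_atTop.comp (Real.tendsto_log_atTop.const_mul_atTop two_pos)
  refine ((tendsto_exp_sq_mul_rpow_mul_gaussian_tail κ x hK).comp ha_top).congr' ?_
  filter_upwards [eventually_gt_atTop 1] with S hS
  have hS' : Real.exp (a S ^ 2 / 2) = S := by
    rw [ha, Real.sq_sqrt (by linarith [Real.log_pos hS]), mul_div_cancel_left₀ _ two_ne_zero,
      Real.exp_log (by linarith)]
  have huS : u S = a S +
      (x + Real.log ((2 * Real.pi) ^ (-(1:ℝ) / 2) * C * a S ^ (κ - 1))) / a S := by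
    rw [hu, hb]
    ring
  simp only [Function.comp_apply]
  rw [← huS, hS', hΨ, MeasureTheory.integral_const_mul]
  ring
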